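/- arXiv:1211.5450 — 2 statements merged into one kernel-verified Lean document; each statement's English description precedes it below -/
import Mathlib

section
/- Let A be a simple unital C*-algebra over ℂ (every closed two-sided ideal of A is {0} or A). Suppose that for every finite set F ⊆ A, every ε > 0, and every nonzero positive a ∈ A, there exist a nonzero projection p ∈ A and a closed *-subalgebra C ⊆ A with p ∈ C, p c = c p = c for all c ∈ C (p is the unit of C), such that: (i) C has real rank zero, i.e. for every self-adjoint y ∈ C and every δ > 0 there is a self-adjoint z ∈ C which is invertible in C (there is w ∈ C with z w = w z = p) and ‖y − z‖ < δ; (ii) ‖x p − p x‖ < ε for all x ∈ F; (iii) for each x ∈ F there is c ∈ C with ‖p x p − c‖ < ε; and (iv) (1 − p) ⪯ a. Then A has real rank zero: the set of invertible self-adjoint elements of A is dense in the set of self-adjoint elements of A. -/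
/-- A projection in a C*-algebra: a self-adjoint idempotent. -/
def IsProjection {A : Type*} [Mul A] [Star A] (p : A) : Prop :=
  star p = p ∧ p * p = p

/-- A positive element of a C*-algebra: an element of the form `star y * y`. -/
def IsPositiveElem {A : Type*} [Mul A] [Star A] (x : A) : Prop :=
  ∃ y, x = star y * y

/-- The hereditary subalgebra `Her x`: the norm-closure of `x A x`. -/
def Her {A : Type*} [Mul A] [TopologicalSpace A] (x : A) : Set A :=
  closure {y | ∃ a, y = x * a * x}

/-- Blackadar subequivalence (specialized to projections): `p ⪯ x` iff there is `v` with
`v * v* = p` and `v* * v ∈ Her x`. -/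
def ProjSubEquiv {A : Type*} [Mul A] [Star A] [TopologicalSpace A] (p x : A) : Prop :=
  ∃ v, v * star v = p ∧ star v * v ∈ Her x

/-- Property (SP): every nonzero positive element has a nonzero projection in its
hereditary subalgebra. -/
def HasSP (A : Type*) [NonUnitalNonAssocSemiring A] [Star A] [TopologicalSpace A] : Prop :=
  ∀ a : A, IsPositiveElem a → a ≠ 0 → ∃ p ∈ Her a, IsProjection p ∧ p ≠ 0

/-- A full positive element: every closed two-sided ideal containing it is all of `A`. -/
def IsFull {A : Type*} [NonUnitalNonAssocRing A] [TopologicalSpace A] (x : A) : Prop :=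
  ∀ I : TwoSidedIdeal A, IsClosed (I : Set A) → x ∈ I → ∀ a : A, a ∈ I

/-- The strict Rokhlin property for an action of a finite group `G` on a unital
C*-algebra `A` by *-automorphisms. -/
def StrictRokhlin {A : Type*} [Ring A] [StarRing A] [Algebra ℂ A] [Norm A]
    {G : Type*} [Group G] [Fintype G] (α : G → A ≃⋆ₐ[ℂ] A) : Prop :=
  ∀ (F : Finset A) (ε : ℝ), 0 < ε →
    ∃ e : G → A, (∀ g, IsProjection (e g)) ∧
      (∀ g h, g ≠ h → e g * e h = 0) ∧
      (∑ g, e g) = 1 ∧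
      (∀ g h, ‖α g (e h) - e (g * h)‖ < ε) ∧
      (∀ g, ∀ a ∈ F, ‖e g * a - a * e g‖ < ε)

/-- The tracial Rokhlin property for an action of a finite group `G` on a unital
C*-algebra `A` by *-automorphisms. -/
def TracialRokhlin {A : Type*} [Ring A] [StarRing A] [Algebra ℂ A] [Norm A]
    [TopologicalSpace A]
    {G : Type*} [Group G] [Fintype G] (α : G → A ≃⋆ₐ[ℂ] A) : Prop :=
  ∀ (F : Finset A) (ε : ℝ), 0 < ε → ∀ x : A, IsPositiveElem x → ‖x‖ = 1 →
    ∃ e : G → A, (∀ g, IsProjection (e g)) ∧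
      (∀ g h, g ≠ h → e g * e h = 0) ∧
      (∀ g h, ‖α g (e h) - e (g * h)‖ < ε) ∧
      (∀ g, ∀ a ∈ F, ‖e g * a - a * e g‖ < ε) ∧
      ProjSubEquiv (1 - ∑ g, e g) x ∧
      ‖(∑ g, e g) * x * (∑ g, e g)‖ > 1 - ε

/-- The weak tracial Rokhlin property for an action of a finite group `G` on a unital
C*-algebra `A` by *-automorphisms. -/
def WeakTracialRokhlin {A : Type*} [Ring A] [StarRing A] [Algebra ℂ A] [Norm A]
    [TopologicalSpace A]
    {G : Type*} [Group G] [Fintype G] (α : G → A ≃⋆ₐ[ℂ] A) : Prop :=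
  ∀ (F : Finset A) (ε : ℝ), 0 < ε →
    ∀ b : A, IsPositiveElem b → ‖b‖ = 1 →
    ∀ x : A, IsPositiveElem x → IsFull x →
    ∃ e : G → A, (∀ g, IsProjection (e g)) ∧
      (∀ g h, g ≠ h → e g * e h = 0) ∧
      (∀ g h, ‖α g (e h) - e (g * h)‖ < ε) ∧
      (∀ g, ∀ a ∈ F, ‖e g * a - a * e g‖ < ε) ∧
      ProjSubEquiv (1 - ∑ g, e g) x ∧
      ‖(∑ g, e g) * b * (∑ g, e g)‖ > 1 - ε

section helpers

variable {A : Type*} [CStarAlgebra A]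

/-- Norm of a projection. -/
lemma aux_proj_norm {p : A} (hp : IsProjection p) : ‖p‖ ≤ 1 := by
  have h := CStarRing.norm_star_mul_self (x := p)
  rw [hp.1, hp.2] at h
  by_contra hc
  push Not at hc
  nlinarith

lemma aux_sub_proj {p : A} (hp : IsProjection p) : IsProjection (1 - p) := by
  refine ⟨by simp [hp.1], ?_⟩
  have := hp.2
  simp only [sub_mul, mul_sub, one_mul, mul_one, this]; simp

lemma aux_near_proj (c : A) (hc : star c = c) (η : ℝ) (hη : ‖c * c - c‖ ≤ η) (hη8 : η ≤ 1 / 8) :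
    ∃ P : A, IsProjection P ∧ ‖P - c‖ ≤ 2 * η ∧
      ∀ C : NonUnitalStarSubalgebra ℂ A, IsClosed (C : Set A) → c ∈ C → P ∈ C := by
  have hsa : IsSelfAdjoint c := hc
  have hη0 : 0 ≤ η := (norm_nonneg _).trans hη
  have hspec : ∀ t ∈ spectrum ℝ c, |t * t - t| ≤ η := by
    intro t ht
    have h1 : c * c - c = cfc (fun t : ℝ => t * t - t) c := by
      rw [cfc_sub (fun t : ℝ => t * t) (fun t => t) c, cfc_mul (fun t : ℝ => t) (fun t => t) c]
      simp [cfc_id' ℝ c]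
    rw [h1] at hη
    have := (norm_cfc_le_iff (fun t : ℝ => t * t - t) c hη0).1 hη t ht
    simpa using this
  let f : ℝ → ℝ := fun t => max 0 (min 1 (2 * t - 1 / 2))
  have hf : Continuous f := by fun_prop
  have hf0 : f 0 = 0 := by simp only [f]; norm_num
  have hcase : ∀ t ∈ spectrum ℝ c, f t * f t = f t ∧ |f t - t| ≤ 2 * η := by
    intro t ht
    have h1 := abs_le.1 (hspec t ht)
    rcases le_total t (1/2) with h | h
    · have h2 : t ≤ 1/4 := by
        by_contra hcon
        push Not at hcon
        nlinarith [mul_pos (sub_pos.2 hcon) (sub_pos.2 hcon)]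
      have h3 : f t = 0 := by
        simp only [f]
        rw [max_eq_left]
        exact (min_le_right _ _).trans (by linarith)
      rw [h3]
      refine ⟨by simp, ?_⟩
      rw [abs_le]
      constructor <;> nlinarith
    · have h2 : 3/4 ≤ t := by
        by_contra hcon
        push Not at hcon
        nlinarith [mul_pos (sub_pos.2 hcon) (sub_pos.2 hcon)]
      have h3 : f t = 1 := by
        simp only [f]
        rw [min_eq_left (by linarith)]
        simp
      rw [h3]
      refine ⟨by simp, ?_⟩
      rw [abs_le]
      constructor <;> nlinarith
  refine ⟨cfc f c, ⟨(cfc_predicate f c : IsSelfAdjoint _), ?_⟩, ?_, ?_⟩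
  · rw [← cfc_mul f f c]
    exact cfc_congr fun t ht => (hcase t ht).1
  · have : cfc f c - c = cfc (fun t => f t - t) c := by
      rw [cfc_sub f (fun t => t) c, cfc_id' ℝ c]
    rw [this]
    refine norm_cfc_le (by linarith) fun t ht => ?_
    simpa using (hcase t ht).2
  · intro C hC hcC
    rw [← cfcₙ_eq_cfc (hf := hf.continuousOn) (hf0 := hf0)]
    have : IsClosed (C : Set A) := hC
    exact cfcₙ_mem (𝕜' := ℂ) f hcC

lemma aux_subequiv (r s : A) (hr : IsProjection r) (hs : IsProjection s)
    (h : ‖r - r * s * r‖ < 1) :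
    ∃ v : A, v * star v = r ∧ v * s = v := by
  have hr2 := hr.2
  have hs2 := hs.2
  set m : A := 1 - (r - r * s * r) with hm
  have hmsa : IsSelfAdjoint m := by
    show star m = m
    simp [hm, hr.1, hs.1, mul_assoc]
  have hpos : ∀ t ∈ spectrum ℝ m, 0 < t := by
    intro t ht
    have h1 : r - r * s * r = cfc (fun t : ℝ => 1 - t) m := by
      rw [cfc_sub (fun _ : ℝ => 1) (fun t => t) m, cfc_id' ℝ m, cfc_const_one ℝ m]
      simp [hm]
    rw [h1] at h
    have := (norm_cfc_le_iff (fun t : ℝ => 1 - t) m (norm_nonneg _)).1 le_rfl t ht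
    have h2 := (abs_le.1 (by simpa using this : |1 - t| ≤ _)).2
    linarith
  have hcont : ContinuousOn (fun t : ℝ => (√t)⁻¹) (spectrum ℝ m) := by
    apply ContinuousOn.inv₀
    · exact Real.continuous_sqrt.continuousOn
    · intro t ht
      exact (Real.sqrt_pos.2 (hpos t ht)).ne'
  set k : A := cfc (fun t : ℝ => (√t)⁻¹) m with hk
  have hksa : star k = k := (cfc_predicate (fun t : ℝ => (√t)⁻¹) m : IsSelfAdjoint _)
  have hkm : k * m * k = 1 := by
    have : k * m * k = cfc (fun t : ℝ => (√t)⁻¹ * t * (√t)⁻¹) m := by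
      rw [cfc_mul (fun t : ℝ => (√t)⁻¹ * t) (fun t : ℝ => (√t)⁻¹) m
          (hcont.mul continuousOn_id) hcont,
        cfc_mul (fun t : ℝ => (√t)⁻¹) (fun t : ℝ => t) m hcont continuousOn_id, cfc_id' ℝ m]
    rw [this, ← cfc_const_one ℝ m]
    refine cfc_congr fun t ht => ?_
    have h0 := hpos t ht
    have h1 := Real.sqrt_pos.2 h0
    have h2 := Real.mul_self_sqrt h0.le
    field_simp
    nlinarith
  have hmr : m * r = r * s * r := by
    simp only [hm, sub_mul, mul_assoc, hr2, one_mul]; simp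
  have hrm : r * m = r * s * r := by
    simp only [hm, mul_sub, mul_one, ← mul_assoc, hr2]; simp
  have hcomm : Commute m r := by rw [commute_iff_eq, hmr, hrm]
  have hkr : Commute k r := hmsa.commute_cfc hcomm _
  refine ⟨k * r * s, ?_, ?_⟩
  · calc k * r * s * star (k * r * s) = k * (r * (s * s) * r) * k := by
          simp only [star_mul, hksa, hr.1, hs.1, mul_assoc]
      _ = k * m * (r * k) := by rw [hs2, ← hmr]; simp only [mul_assoc]
      _ = r := by rw [← hkr.eq, ← mul_assoc, hkm, one_mul]
  · rw [mul_assoc, hs2]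

lemma aux_schur (C : NonUnitalStarSubalgebra ℂ A) (p : A) (hp : IsProjection p) (hpC : p ∈ C)
    (hunit : ∀ c ∈ C, p * c = c ∧ c * p = c)
    (hRR : ∀ y ∈ C, star y = y → ∀ δ : ℝ, 0 < δ →
          ∃ z ∈ C, star z = z ∧ (∃ w ∈ C, z * w = p ∧ w * z = p) ∧ ‖y - z‖ < δ)
    (e : A) (he : IsProjection e) (heC : e ∈ C) (y : A) (hy : y ∈ C) (hys : star y = y)
    (hey : e * y = y) (hye : y * e = y) (δ : ℝ) (hδ : 0 < δ) :
    ∃ z w : A, star z = z ∧ e * z = z ∧ z * e = z ∧ e * w = w ∧ z * w = e ∧ ‖y - z‖ < δ := by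
  obtain ⟨hes, he2⟩ := he
  have hpe := (hunit e heC).1
  have hep := (hunit e heC).2
  set f := p - e with hf
  have hfC : f ∈ C := sub_mem hpC heC
  have hfs : star f = f := by simp [hf, hp.1, hes]
  have hf2 : f * f = f := by
    simp only [hf, sub_mul, mul_sub, hp.2, hpe, hep, he2]; abel
  have hef : e * f = 0 := by simp [hf, mul_sub, hep, he2]
  have hfe : f * e = 0 := by simp [hf, sub_mul, hpe, he2]
  have hyf : y * f = 0 := by rw [← hye, mul_assoc, hef, mul_zero]
  have hfy : f * y = 0 := by rw [← hey, ← mul_assoc, hfe, zero_mul]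
  have hne := aux_proj_norm (p := e) ⟨hes, he2⟩
  have hnf := aux_proj_norm (p := f) ⟨hfs, hf2⟩
  set δ₁ := min (1/2) (δ/4) with hdel
  have hdel0 : 0 < δ₁ := by positivity
  have hdel1 : δ₁ ≤ 1/2 := min_le_left _ _
  have hdel2 : δ₁ ≤ δ/4 := min_le_right _ _
  obtain ⟨Z, hZC, hZs, ⟨W, hWC, hZW, -⟩, hZ⟩ := hRR (y + f) (add_mem hy hfC)
    (by simp [hys, hfs]) δ₁ hdel0
  set D := Z - (y + f) with hD
  have hDn : ‖D‖ < δ₁ := by rw [hD, norm_sub_rev]; exact hZ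
  have hZD : Z = y + f + D := by rw [hD]; abel
  have hDs : star D = D := by simp [hD, hys, hfs, hZs]
  -- f Z f = f + f D f
  have hfZf : f * Z * f = f + f * D * f := by
    rw [hZD]; simp only [mul_add, add_mul, hfy, hf2, zero_mul, zero_add]
  have hfDf : ‖f * D * f‖ < δ₁ := by
    calc ‖f * D * f‖ ≤ ‖f‖ * ‖D‖ * ‖f‖ := norm_mul₃_le
      _ ≤ 1 * ‖D‖ * 1 := by gcongr
      _ < δ₁ := by simpa using hDn
  have hlt : ‖-(f * D * f)‖ < 1 := by rw [norm_neg]; linarith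
  obtain ⟨u, hu⟩ : IsUnit (1 - -(f * D * f)) := isUnit_one_sub_of_norm_lt_one hlt
  set j : A := ((u⁻¹ : Aˣ) : A) with hj
  have hu' : (u : A) = 1 + f * D * f := by rw [hu]; abel
  have huj : (1 + f * D * f) * j = 1 := by rw [← hu', hj]; simp
  have hju : j * (1 + f * D * f) = 1 := by rw [← hu', hj]; simp
  have hus : star (1 + f * D * f) = 1 + f * D * f := by simp [hfs, hDs, mul_assoc]
  have hjs : star j = j := by
    have h1 : star j * (1 + f * D * f) = 1 := by
      have := congrArg star huj
      rwa [star_mul, hus, star_one] at this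
    calc star j = star j * ((1 + f * D * f) * j) := by rw [huj, mul_one]
      _ = j := by rw [← mul_assoc, h1, one_mul]
  have hjn : ‖j‖ ≤ 2 * 1 := by
    have h1 : j = 1 - (f * D * f) * j := by
      rw [add_mul, one_mul] at huj; rw [← huj]; abel
    have h2 : ‖j‖ ≤ 1 + (1/2) * ‖j‖ := by
      calc ‖j‖ = ‖1 - (f * D * f) * j‖ := by rw [← h1]
        _ ≤ ‖(1 : A)‖ + ‖(f * D * f) * j‖ := norm_sub_le _ _
        _ ≤ 1 + ‖f * D * f‖ * ‖j‖ := by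
            gcongr
            · exact aux_proj_norm ⟨by simp, by simp⟩
            · exact norm_mul_le _ _
        _ ≤ 1 + (1/2) * ‖j‖ := by
            gcongr; linarith
    linarith
  have hcomm : f * (1 + f * D * f) = (1 + f * D * f) * f := by
    simp only [mul_add, add_mul, mul_one, one_mul, ← mul_assoc, hf2]
    simp only [mul_assoc, hf2]
  have hfj : f * j = j * f := by
    calc f * j = j * ((1 + f * D * f) * f) * j := by rw [← mul_assoc, hju, one_mul]
      _ = j * f * ((1 + f * D * f) * j) := by rw [← hcomm]; simp only [mul_assoc]
      _ = j * f := by rw [huj, mul_one]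
  set d := f * j * f with hd
  have hds : star d = d := by simp [hd, hfs, hjs, mul_assoc]
  have hdf : d * f = d := by rw [hd, mul_assoc, hf2]
  have hfd : f * d = d := by rw [hd, ← mul_assoc, ← mul_assoc, hf2]
  have hdZ : d * (f * Z * f) = f := by
    have h3 : f * Z * f = (1 + f * D * f) * f := by
      rw [hfZf, add_mul, one_mul, mul_assoc (f * D), hf2]
    have h4 : d = f * j := by rw [hd, hfj, mul_assoc, hf2]
    rw [h3, h4, mul_assoc, ← mul_assoc j, hju, one_mul, hf2]
  have hpZ := hunit Z hZC
  have hpW := hunit W hWC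
  refine ⟨e * Z * e - e * Z * d * Z * e, e * W * e, ?_, ?_, ?_, ?_, ?_, ?_⟩
  · simp [hes, hZs, hds, mul_assoc]
  · simp only [mul_sub, ← mul_assoc, he2]
  · simp only [sub_mul, mul_assoc, he2]
  · simp only [← mul_assoc, he2]
  · have hep' : e = p - f := by rw [hf]; abel
    have h1 : Z * e * W = p - Z * f * W := by
      rw [hep', mul_sub, hpZ.2, sub_mul, hZW]
    have hfp : f * p = f := (hunit f hfC).2
    have h2 : f * (Z * e * W) * e = - (f * Z * f * (W * e)) := by
      rw [h1, mul_sub, sub_mul, hfp, hfe]; simp only [mul_assoc]; simp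
    have h3 : d * (Z * e * W) * e = - (f * W * e) := by
      calc d * (Z * e * W) * e = d * (f * (Z * e * W) * e) := by
            rw [← hdf]; simp only [mul_assoc]; rw [← mul_assoc f f, hf2]
        _ = - (d * (f * Z * f) * (W * e)) := by rw [h2]; simp only [mul_neg, mul_assoc]
        _ = _ := by rw [hdZ, mul_assoc]
    calc (e * Z * e - e * Z * d * Z * e) * (e * W * e)
        = e * (Z * (e * e) * W) * e - e * Z * (d * (Z * (e * e) * W) * e) := by
          simp only [sub_mul, mul_assoc]
      _ = e := by
          rw [he2, h3, h1]
          simp only [mul_sub, sub_mul, mul_neg, mul_assoc]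
          rw [hpe, he2]; abel
  · have h1 : e * Z * e = y + e * D * e := by
      rw [hZD]; simp only [mul_add, add_mul, hey, hye, hef, zero_mul, add_zero]
    have h2 : e * Z * f = e * D * f := by
      rw [hZD]; simp only [mul_add, add_mul, hey, hyf, hef, zero_mul, zero_add]
    have h3 : f * Z * e = f * D * e := by
      rw [hZD]; simp only [mul_add, add_mul, hfy, hf2, hfe, zero_mul, zero_add]
    have h4 : e * Z * d * Z * e = (e * D * f) * j * (f * D * e) := by
      rw [← h2, ← h3, hd]; simp only [mul_assoc]
    rw [h4, h1]
    have h5 : y - (y + e * D * e - (e * D * f) * j * (f * D * e))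
      = (e * D * f) * j * (f * D * e) - e * D * e := by abel
    rw [h5]
    have a1 : ‖e * D * f‖ ≤ δ₁ := by
      calc ‖e * D * f‖ ≤ ‖e‖ * ‖D‖ * ‖f‖ := norm_mul₃_le
        _ ≤ 1 * δ₁ * 1 := by gcongr
        _ = δ₁ := by ring
    have a2 : ‖f * D * e‖ ≤ δ₁ := by
      calc ‖f * D * e‖ ≤ ‖f‖ * ‖D‖ * ‖e‖ := norm_mul₃_le
        _ ≤ 1 * δ₁ * 1 := by gcongr
        _ = δ₁ := by ring
    have a3 : ‖e * D * e‖ ≤ δ₁ := by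
      calc ‖e * D * e‖ ≤ ‖e‖ * ‖D‖ * ‖e‖ := norm_mul₃_le
        _ ≤ 1 * δ₁ * 1 := by gcongr
        _ = δ₁ := by ring
    calc ‖(e * D * f) * j * (f * D * e) - e * D * e‖
        ≤ ‖(e * D * f) * j * (f * D * e)‖ + ‖e * D * e‖ := norm_sub_le _ _
      _ ≤ ‖e * D * f‖ * ‖j‖ * ‖f * D * e‖ + δ₁ := by gcongr; exact norm_mul₃_le
      _ ≤ δ₁ * (2 * 1) * δ₁ + δ₁ := by gcongr
      _ < δ := by nlinarith

lemma aux_matrix (e r q z w v b : A) (hsum : e + r + q = 1) (hr : IsProjection r)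
    (hq : IsProjection q)
    (her : e * r = 0) (hre : r * e = 0) (heq : e * q = 0) (hqe : q * e = 0)
    (hqr : q * r = 0) (hrq : r * q = 0)
    (hzs : star z = z) (hze : z * e = z) (hew : e * w = w) (hzw : z * w = e)
    (hv : v * star v = r) (hvq : v * q = v) (hbs : star b = b) (hrb : r * b = b) (hbr : b * r = b)
    (δ : ℝ) (hδ : 0 < δ) :
    ∃ Y : A, star Y = Y ∧ IsUnit Y ∧ ‖z + b - Y‖ ≤ 4 * δ := by
  have hqv : q * star v = star v := by
    have := congrArg star hvq
    rwa [star_mul, hq.1] at this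
  have hrv : r * v = v := by
    have h : (v - r * v) * star (v - r * v) = 0 := by
      simp only [star_sub, star_mul, hr.1, sub_mul, mul_sub]
      have h1 : r * v * star v = r := by rw [mul_assoc, hv, hr.2]
      have h2 : v * (star v * r) = r := by rw [← mul_assoc, hv, hr.2]
      have h3 : r * v * (star v * r) = r := by rw [← mul_assoc, h1, hr.2]
      rw [hv, h1, h2, h3]; simp
    have := CStarRing.mul_star_self_eq_zero_iff _ |>.1 h
    exact (sub_eq_zero.1 this).symm
  have hsvr : star v * r = star v := by
    have := congrArg star hrv
    rwa [star_mul, hr.1] at this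
  have hvr : v * r = 0 := by rw [← hvq, mul_assoc, hqr, mul_zero]
  have hrsv : r * star v = 0 := by rw [← hqv, ← mul_assoc, hrq, zero_mul]
  have hvv : v * v = 0 := by
    calc v * v = v * (r * v) := by rw [hrv]
      _ = 0 := by rw [← mul_assoc, hvr, zero_mul]
  have hsvsv : star v * star v = 0 := by rw [← star_mul, hvv, star_zero]
  set s := star v * v with hs
  have hss : star s = s := by simp [hs]
  have hqs : q * s = s := by rw [hs, ← mul_assoc, hqv]
  have hsq : s * q = s := by rw [hs, mul_assoc, hvq]
  have hvs : v * s = v := by rw [hs, ← mul_assoc, hv, hrv]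
  have hssv : s * star v = star v := by rw [hs, mul_assoc, hv, hsvr]
  have hs2 : s * s = s := by
    calc s * s = star v * (v * s) := by rw [hs, mul_assoc]
      _ = s := by rw [hvs]
  have hqv0 : q * v = 0 := by rw [← hrv, ← mul_assoc, hqr, zero_mul]
  have hsv0 : s * v = 0 := by rw [hs, mul_assoc, hvv, mul_zero]
  have hsvq0 : star v * q = 0 := by rw [← hsvr, mul_assoc, hrq, mul_zero]
  have hsvs0 : star v * s = 0 := by rw [hs, ← mul_assoc, hsvsv, zero_mul]
  set G := v + star v + (q - s) with hG
  have hGs : star G = G := by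
    simp only [hG, star_add, star_sub, star_star, hq.1, hss]; abel
  have hGG : G * G = r + q := by
    simp only [hG, add_mul, mul_add, sub_mul, mul_sub, hvv, hsvsv, hv, hvq, hvs, hqv, hssv, hqv0,
      hsv0, hsvq0, hsvs0, hq.2, hqs, hsq, hs2, ← hs]
    abel
  have heG : e * G = 0 := by
    have h1 : e * v = 0 := by rw [← hrv, ← mul_assoc, her, zero_mul]
    have h2 : e * star v = 0 := by rw [← hqv, ← mul_assoc, heq, zero_mul]
    have h3 : e * s = 0 := by rw [← hqs, ← mul_assoc, heq, zero_mul]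
    simp only [hG, mul_add, mul_sub, h1, h2, h3, heq]; simp
  have hes : star e = e := by
    have : e = 1 - r - q := by rw [← hsum]; abel
    rw [this]; simp [hr.1, hq.1]
  have hGe : G * e = 0 := by
    have := congrArg star heG
    rwa [star_mul, hGs, hes, star_zero] at this
  have hzG : z * G = 0 := by rw [← hze, mul_assoc, heG, mul_zero]
  have hGw : G * w = 0 := by rw [← hew, ← mul_assoc, hGe, zero_mul]
  have hbw : b * w = 0 := by
    rw [← hbr, ← hew, mul_assoc, ← mul_assoc r, hre]; simp
  have hbG : b * G = b * v := by
    have h1 : r * G = v := by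
      have h3 : r * s = 0 := by rw [← hqs, ← mul_assoc, hrq, zero_mul]
      simp only [hG, mul_add, mul_sub, hrv, hrsv, hrq, h3]; simp
    rw [← hbr, mul_assoc, h1, mul_assoc, hrv]
  have hbGbG : b * G * (b * G) = 0 := by
    have h1 : v * b = 0 := by rw [← hrb, ← mul_assoc, hvr, zero_mul]
    rw [hbG, mul_assoc, ← mul_assoc v, h1]; simp
  have hrqb : (r + q) * (b * G) = b * G := by
    have : q * b = 0 := by rw [← hrb, ← mul_assoc, hqr, zero_mul]
    rw [← mul_assoc, add_mul, hrb, this, add_zero]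
  set Y := z + b + δ • G with hY
  have hYs : star Y = Y := by simp [hY, hzs, hbs, hGs]
  set W := w + δ⁻¹ • (G * (1 - δ⁻¹ • (b * G))) with hW
  have h1 : Y * w = e := by
    simp only [hY, add_mul, hzw, hbw, smul_mul_assoc, hGw]; simp
  have h2 : Y * G = b * G + δ • (r + q) := by
    simp only [hY, add_mul, hzG, smul_mul_assoc, hGG]; simp
  have hYW : Y * W = 1 := by
    rw [hW, mul_add, h1, mul_smul_comm, ← mul_assoc, h2]
    have h3 : (b * G + δ • (r + q)) * (1 - δ⁻¹ • (b * G)) = δ • (r + q) := by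
      rw [mul_sub, mul_one, mul_smul_comm, add_mul, hbGbG, smul_mul_assoc, hrqb, zero_add,
        smul_smul, inv_mul_cancel₀ hδ.ne', one_smul]
      abel
    rw [h3, smul_smul, inv_mul_cancel₀ hδ.ne', one_smul, ← hsum]; abel
  have hWY : star W * Y = 1 := by
    have := congrArg star hYW
    rwa [star_mul, hYs, star_one] at this
  refine ⟨Y, hYs, ?_, ?_⟩
  · have hWW : star W = W := left_inv_eq_right_inv hWY hYW
    exact ⟨⟨Y, W, hYW, hWW ▸ hWY⟩, rfl⟩
  · have : z + b - Y = - (δ • G) := by rw [hY]; abel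
    rw [this, norm_neg, norm_smul, Real.norm_of_nonneg hδ.le]
    have hvn : ‖v‖ ≤ 1 := by
      have h5 := CStarRing.norm_self_mul_star (x := v)
      rw [hv] at h5
      have := aux_proj_norm hr
      nlinarith [norm_nonneg v]
    have hqn := aux_proj_norm hq
    have hsn := aux_proj_norm (p := s) ⟨hss, hs2⟩
    have hsvn : ‖star v‖ ≤ 1 := by rwa [norm_star]
    have : ‖G‖ ≤ 4 := by
      calc ‖G‖ ≤ ‖v + star v‖ + ‖q - s‖ := norm_add_le _ _
        _ ≤ ‖v‖ + ‖star v‖ + (‖q‖ + ‖s‖) := by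
          gcongr
          · exact norm_add_le _ _
          · exact norm_sub_le _ _
        _ ≤ 4 := by linarith
    nlinarith

lemma aux_symm (C : NonUnitalStarSubalgebra ℂ A) (t : A) (ht : star t = t) (η : ℝ)
    (h : ∃ c ∈ C, ‖t - c‖ < η) : ∃ c ∈ C, star c = c ∧ ‖t - c‖ < η := by
  obtain ⟨c, hc, hn⟩ := h
  have h2 : (1/2 : ℂ) • (t + t) = t := by
    rw [← two_smul ℂ t, smul_smul]; norm_num
  refine ⟨(1/2 : ℂ) • (c + star c), SMulMemClass.smul_mem _ (add_mem hc (star_mem hc)), ?_, ?_⟩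
  · rw [star_smul, star_add, star_star, add_comm]; simp
  · have : t - (1/2 : ℂ) • (c + star c) = (1/2 : ℂ) • ((t - c) + star (t - c)) := by
      nth_rewrite 1 [← h2]
      rw [← smul_sub, star_sub, ht]; congr 1; abel
    rw [this, norm_smul]
    have h3 := norm_add_le (t - c) (star (t - c))
    rw [norm_star] at h3
    have h4 : ‖(1/2 : ℂ)‖ = 1/2 := by norm_num
    rw [h4]
    linarith

lemma aux_nl {a b : A} {s : ℝ} (ha : ‖a‖ ≤ 1) (hb : ‖b‖ ≤ s) : ‖a * b‖ ≤ s := by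
  have := norm_mul_le a b
  nlinarith [norm_nonneg a, norm_nonneg b]

lemma aux_nr {a b : A} {s : ℝ} (ha : ‖a‖ ≤ s) (hb : ‖b‖ ≤ 1) : ‖a * b‖ ≤ s := by
  have := norm_mul_le a b
  nlinarith [norm_nonneg a, norm_nonneg b]

/-- The elements annihilated by `e` on both sides. -/
def auxAnn (e : A) (he : star e = e) : NonUnitalStarSubalgebra ℂ A where
  carrier := {y | e * y = 0 ∧ y * e = 0}
  add_mem' := by
    rintro a b ⟨h1, h2⟩ ⟨h3, h4⟩
    exact ⟨by rw [mul_add, h1, h3, add_zero], by rw [add_mul, h2, h4, add_zero]⟩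
  zero_mem' := ⟨mul_zero _, zero_mul _⟩
  mul_mem' := by
    rintro a b ⟨h1, h2⟩ ⟨h3, h4⟩
    exact ⟨by rw [← mul_assoc, h1, zero_mul], by rw [mul_assoc, h4, mul_zero]⟩
  smul_mem' := by
    rintro c a ⟨h1, h2⟩
    exact ⟨by rw [mul_smul_comm, h1, smul_zero], by rw [smul_mul_assoc, h2, smul_zero]⟩
  star_mem' := by
    rintro a ⟨h1, h2⟩
    constructor
    · have := congrArg star h2
      rwa [star_mul, he, star_zero] at this
    · have := congrArg star h1
      rwa [star_mul, he, star_zero] at this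

lemma auxAnn_closed (e : A) (he : star e = e) : IsClosed (auxAnn e he : Set A) := by
  have : (auxAnn e he : Set A) = {y | e * y = 0} ∩ {y | y * e = 0} := rfl
  rw [this]
  exact (isClosed_eq (by fun_prop) continuous_const).inter
    (isClosed_eq (by fun_prop) continuous_const)

lemma aux_her_zero {x a y : A} (hxa : x * a = 0) (hy : y ∈ Her a) : x * y = 0 := by
  have hcl : IsClosed {y : A | x * y = 0} := isClosed_eq (by fun_prop) continuous_const
  refine closure_minimal ?_ hcl hy
  rintro _ ⟨b, rfl⟩
  show x * (a * b * a) = 0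
  rw [← mul_assoc, ← mul_assoc, hxa]; simp

lemma aux_main
    (hTA : ∀ (F : Finset A) (ε : ℝ), 0 < ε → ∀ a : A, IsPositiveElem a → a ≠ 0 →
      ∃ (p : A) (C : NonUnitalStarSubalgebra ℂ A), IsClosed (C : Set A) ∧
        IsProjection p ∧ p ≠ 0 ∧ p ∈ C ∧
        (∀ c ∈ C, p * c = c ∧ c * p = c) ∧
        (∀ y ∈ C, star y = y → ∀ δ : ℝ, 0 < δ →
          ∃ z ∈ C, star z = z ∧ (∃ w ∈ C, z * w = p ∧ w * z = p) ∧ ‖y - z‖ < δ) ∧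
        (∀ x ∈ F, ‖x * p - p * x‖ < ε) ∧
        (∀ x ∈ F, ∃ c ∈ C, ‖p * x * p - c‖ < ε) ∧
        ProjSubEquiv (1 - p) a)
    (x q : A) (hx : star x = x) (hq : IsProjection q) (hq0 : q ≠ 0) (hxq : x * q = 0)
    (ε : ℝ) (hε : 0 < ε) :
    ∃ z : A, star z = z ∧ IsUnit z ∧ ‖x - z‖ < ε := by
  classical
  set M := ‖x‖ with hM
  have hM0 : 0 ≤ M := norm_nonneg x
  obtain ⟨η, hη0, hη1, hη2⟩ : ∃ η : ℝ, 0 < η ∧ η ≤ 1/1000 ∧ (4 + 216 * M) * η ≤ ε / 2 := by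
    refine ⟨min (1/1000) (ε / 2 / (4 + 216 * M)), by positivity, min_le_left _ _, ?_⟩
    have h1 : min (1/1000) (ε / 2 / (4 + 216 * M)) ≤ ε / 2 / (4 + 216 * M) := min_le_right _ _
    rw [le_div_iff₀ (by positivity)] at h1
    linarith
  obtain ⟨p, C, hCc, hp, -, hpC, hunit, hRR, hcom, happ, u, huu, huH⟩ :=
    hTA {x, q} η hη0 q ⟨q, by rw [hq.1, hq.2]⟩ hq0
  have hxp := (hcom x (by simp)).le
  have hqp := (hcom q (by simp)).le
  have hps := hp.1
  have hqs := hq.1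
  have hp2 := hp.2
  have hq2 := hq.2
  have hpn := aux_proj_norm hp
  have hqn := aux_proj_norm hq
  -- approximants
  obtain ⟨c, hcC, hcs, hc⟩ := aux_symm C (p * q * p) (by simp [hps, hqs, mul_assoc]) η
    (happ q (by simp))
  obtain ⟨cx, hcxC, hcxs, hcx⟩ := aux_symm C (p * x * p) (by simp [hps, hx, mul_assoc]) η
    (happ x (by simp))
  -- u q = u
  have huq : u * q = u := by
    have h1 : (1 - q) * (star u * u) = 0 :=
      aux_her_zero (a := q) (by rw [sub_mul, one_mul, hq2, sub_self]) huH
    have h2 : star (u * (1 - q)) * (u * (1 - q)) = 0 := by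
      rw [star_mul, star_sub, star_one, hqs, mul_assoc, ← mul_assoc (star u), ← mul_assoc, h1,
        zero_mul]
    have h3 := CStarRing.star_mul_self_eq_zero_iff _ |>.1 h2
    rw [mul_sub, mul_one, sub_eq_zero] at h3
    exact h3.symm
  -- projection q1 in C near pqp
  set t := p * q * p with ht
  have htn : ‖t‖ ≤ 1 := aux_nr (aux_nl hpn hqn) hpn
  have htt : ‖t * t - t‖ ≤ η := by
    have : t * t - t = - (p * q * (q * p - p * q) * p) := by
      have h1 : p * q * (q * p - p * q) * p = p * (q * q) * (p * p) - p * q * p * q * p := by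
        simp only [mul_sub, sub_mul, mul_assoc]
      have h2 : t * t = p * q * (p * p) * q * p := by simp only [ht, mul_assoc]
      rw [h1, h2, hp2, hq2]; abel
    rw [this, norm_neg]
    exact aux_nr (aux_nl (aux_nl hpn hqn) hqp) hpn
  have hcc : ‖c * c - c‖ ≤ 5 * η := by
    have h1 : c * c - c = (t * t - t) - ((t - c) * t + c * (t - c)) + (t - c) := by
      simp only [mul_sub, sub_mul]; abel
    have hcn : ‖c‖ ≤ 2 := by
      have : c = t - (t - c) := by abel
      calc ‖c‖ = ‖t - (t - c)‖ := by rw [← this]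
        _ ≤ ‖t‖ + ‖t - c‖ := norm_sub_le _ _
        _ ≤ 2 := by linarith
    have h2 : ‖(t - c) * t‖ ≤ η := aux_nr hc.le htn
    have h3 : ‖c * (t - c)‖ ≤ 2 * η := by
      calc _ ≤ ‖c‖ * ‖t - c‖ := norm_mul_le _ _
        _ ≤ 2 * η := by gcongr
    rw [h1]
    calc _ ≤ ‖(t * t - t) - ((t - c) * t + c * (t - c))‖ + ‖t - c‖ := norm_add_le _ _
      _ ≤ ‖t * t - t‖ + ‖(t - c) * t + c * (t - c)‖ + ‖t - c‖ := by gcongr; exact norm_sub_le _ _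
      _ ≤ ‖t * t - t‖ + (‖(t - c) * t‖ + ‖c * (t - c)‖) + ‖t - c‖ := by
        gcongr; exact norm_add_le _ _
      _ ≤ 5 * η := by linarith
  obtain ⟨q1, hq1, hq1c, hq1C⟩ := aux_near_proj c hcs (5 * η) hcc (by linarith)
  have hq1C := hq1C C hCc hcC
  have hq1t : ‖q1 - t‖ ≤ 11 * η := by
    have : q1 - t = (q1 - c) - (t - c) := by abel
    rw [this]
    have := norm_sub_le (q1 - c) (t - c)
    linarith
  have hpq1 := (hunit q1 hq1C).1
  have hq1p := (hunit q1 hq1C).2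
  -- the projection e
  obtain ⟨e, he⟩ : ∃ e, e = p - q1 := ⟨_, rfl⟩
  have heC : e ∈ C := he ▸ sub_mem hpC hq1C
  have heP : IsProjection e := by
    refine ⟨by rw [he]; simp [hps, hq1.1], ?_⟩
    rw [he]; simp only [sub_mul, mul_sub, hp2, hpq1, hq1p, hq1.2]; abel
  have hen := aux_proj_norm heP
  have hes := heP.1
  have he2 := heP.2
  have hep := (hunit e heC).2
  have hpe := (hunit e heC).1
  have h1e := aux_proj_norm (aux_sub_proj heP)
  have hpqpq : ‖p * q - t * q‖ ≤ η := by
    have : p * q - t * q = - (p * (q * p - p * q) * q) := by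
      have h1 : p * (q * p - p * q) * q = p * q * p * q - (p * p) * (q * q) := by
        simp only [mul_sub, sub_mul, mul_assoc]
      rw [h1, hp2, hq2, ht]; abel
    rw [this, norm_neg]
    exact aux_nr (aux_nl hpn hqp) hqn
  have heq : ‖e * q‖ ≤ 12 * η := by
    have : e * q = (p * q - t * q) - (q1 - t) * q := by
      rw [he]; simp only [sub_mul]; abel
    rw [this]
    have h1 : ‖(q1 - t) * q‖ ≤ 11 * η := aux_nr hq1t hqn
    have := norm_sub_le (p * q - t * q) ((q1 - t) * q)
    linarith
  have hqe : ‖q * e‖ ≤ 12 * η := by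
    have : star (e * q) = q * e := by rw [star_mul, hes, hqs]
    rw [← this, norm_star]; exact heq
  -- the projection near q orthogonal to e
  set d := (1 - e) * q * (1 - e) with hd
  have hdd : ‖d * d - d‖ ≤ 12 * η := by
    have h1 : d * d - d = - ((1 - e) * (q * ((e * q) * (1 - e)))) := by
      have h0 := (aux_sub_proj heP).2
      have h2 : d * d = (1 - e) * q * ((1 - e) * (1 - e)) * q * (1 - e) := by
        simp only [hd, mul_assoc]
      have h3 : d = (1 - e) * (q * q) * (1 - e) := by rw [hq2]
      have h4 : (1 - e) * (q * ((e * q) * (1 - e))) = (1 - e) * (q * q) * (1 - e)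
          - (1 - e) * q * (1 - e) * q * (1 - e) := by
        have h5 : (1 - e) * q * (1 - e) * q * (1 - e)
            = (1 - e) * (q * q - q * e * q) * (1 - e) := by
          congr 1
          rw [mul_assoc, mul_assoc]; congr 1
          rw [sub_mul, mul_sub, one_mul, mul_assoc]
        rw [h5, ← sub_mul, ← mul_sub (1 - e) (q * q), sub_sub_cancel]
        simp only [mul_assoc]
      rw [h4, h2, h0, hq2, ← hd]; abel
    rw [h1, norm_neg]
    exact aux_nl h1e (aux_nl hqn (aux_nr heq h1e))
  have hdq : ‖d - q‖ ≤ 24 * η := by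
    have h1 : d - q = - (e * q) - (1 - e) * (q * e) := by
      rw [hd]; simp only [mul_sub, sub_mul, one_mul, mul_one, mul_assoc]; abel
    rw [h1]
    have h2 := norm_sub_le (-(e * q)) ((1 - e) * (q * e))
    rw [norm_neg] at h2
    have h3 := aux_nl h1e hqe
    linarith
  obtain ⟨k, hk, hkd, hkC⟩ := aux_near_proj d (by simp [hd, hes, hqs, mul_assoc]) (12 * η) hdd
    (by linarith)
  obtain ⟨hek, hke⟩ : e * k = 0 ∧ k * e = 0 := by
    refine hkC (auxAnn e hes) (auxAnn_closed e hes) ⟨?_, ?_⟩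
    · have h1 : e * (1 - e) = 0 := by rw [mul_sub, he2, mul_one, sub_self]
      rw [hd, ← mul_assoc, ← mul_assoc, h1]; simp
    · have h1 : (1 - e) * e = 0 := by rw [sub_mul, he2, one_mul, sub_self]
      rw [hd, mul_assoc, h1, mul_zero]
  have hkq : ‖k - q‖ ≤ 48 * η := by
    have : k - q = (k - d) + (d - q) := by abel
    rw [this]
    have := norm_add_le (k - d) (d - q)
    linarith
  have hkn := aux_proj_norm hk
  have hks := hk.1
  have hk2 := hk.2
  obtain ⟨r, hr⟩ : ∃ r, r = 1 - e - k := ⟨_, rfl⟩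
  have hsum : e + r + k = 1 := by rw [hr]; abel
  have her : e * r = 0 := by rw [hr]; simp [mul_sub, he2, hek]
  have hre : r * e = 0 := by rw [hr]; simp [sub_mul, he2, hke]
  have hkr : k * r = 0 := by rw [hr]; simp [mul_sub, hk2, hke]
  have hrk : r * k = 0 := by rw [hr]; simp [sub_mul, hk2, hek]
  have hrP : IsProjection r := by
    refine ⟨by rw [hr]; simp [hes, hks], ?_⟩
    nth_rewrite 1 [hr]
    simp only [sub_mul, one_mul, her, hkr]; simp
  have hrn := aux_proj_norm hrP
  have hrs := hrP.1
  have hrp : ‖r * p‖ ≤ 60 * η := by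
    have h1 : r * p = (q1 - t) - (q * p - p * q) * p - (k - q) * p := by
      have : (q * p - p * q) * p = q * p - t := by rw [sub_mul, mul_assoc, hp2, ht]
      rw [this, hr, he]
      simp only [sub_mul, one_mul, hp2, hq1p]; abel
    rw [h1]
    have a1 : ‖(q * p - p * q) * p‖ ≤ η := aux_nr hqp hpn
    have a2 : ‖(k - q) * p‖ ≤ 48 * η := aux_nr hkq hpn
    have a3 := norm_sub_le ((q1 - t) - (q * p - p * q) * p) ((k - q) * p)
    have a4 := norm_sub_le (q1 - t) ((q * p - p * q) * p)
    linarith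
  have hpr : ‖p * r‖ ≤ 60 * η := by
    have : star (r * p) = p * r := by rw [star_mul, hrs, hps]
    rw [← this, norm_star]; exact hrp
  -- subequivalences
  obtain ⟨v1, hv1, hv1p⟩ := aux_subequiv r (1 - p) hrP (aux_sub_proj hp) (by
    have : r - r * (1 - p) * r = r * p * r := by
      simp only [mul_sub, sub_mul, mul_one, hrP.2]; abel
    rw [this]
    have := aux_nr hrp hrn
    linarith)
  obtain ⟨v2, hv2, hv2k⟩ := aux_subequiv q k hq hk (by
    have : q - q * k * q = - (q * (k - q) * q) := by
      simp only [mul_sub, sub_mul, hq2]; abel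
    rw [this, norm_neg]
    have := aux_nr (aux_nl hqn hkq) hqn
    linarith)
  set v := v1 * u * v2 with hv
  have hvv : v * star v = r := by
    have : v * star v = v1 * (u * (v2 * star v2) * star u) * star v1 := by
      simp only [hv, star_mul, mul_assoc]
    rw [this, hv2, huq, huu, hv1p, hv1]
  have hvk : v * k = v := by rw [hv, mul_assoc, hv2k]
  -- the corner
  obtain ⟨z, w, hzs, hez, hze, hew, hzw, hzn⟩ := aux_schur C p hp hpC hunit hRR e heP heC
    (e * cx * e) (mul_mem (mul_mem heC hcxC) heC) (by simp [hes, hcxs, mul_assoc])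
    (by rw [← mul_assoc, ← mul_assoc, he2]) (by rw [mul_assoc, he2]) η hη0
  obtain ⟨Y, hYs, hYu, hYn⟩ := aux_matrix e r k z w v (r * x * r) hsum hrP hk her hre hek hke hkr
    hrk hzs hze hew hzw hvv hvk (by simp [hrs, hx, mul_assoc])
    (by rw [← mul_assoc, ← mul_assoc, hrP.2]) (by rw [mul_assoc, hrP.2]) (ε / 16) (by positivity)
  refine ⟨Y, hYs, hYu, ?_⟩
  -- final estimate
  have b1 : ‖e * x * r‖ ≤ η + M * (60 * η) := by
    have h1 : e * x * r = - (e * (x * p - p * x) * r) + e * (x * (p * r)) := by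
      have : e * (x * p - p * x) * r = e * (x * (p * r)) - (e * p) * x * r := by
        simp only [mul_sub, sub_mul, mul_assoc]
      rw [this, hep]; abel
    rw [h1]
    have h2 : ‖e * (x * p - p * x) * r‖ ≤ η := aux_nr (aux_nl hen hxp) hrn
    have h3 : ‖e * (x * (p * r))‖ ≤ M * (60 * η) := by
      refine aux_nl hen ((norm_mul_le _ _).trans ?_)
      gcongr
    have h4 := norm_add_le (- (e * (x * p - p * x) * r)) (e * (x * (p * r)))
    rw [norm_neg] at h4
    linarith
  have b2 : ‖r * x * e‖ ≤ η + M * (60 * η) := by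
    have : star (e * x * r) = r * x * e := by simp [hes, hx, hrs, mul_assoc]
    rw [← this, norm_star]; exact b1
  have b3 : ‖x * k‖ ≤ M * (48 * η) := by
    have : x * k = x * (k - q) := by rw [mul_sub, hxq, sub_zero]
    rw [this]
    refine (norm_mul_le _ _).trans ?_
    gcongr
  have b4 : ‖k * x * (e + r)‖ ≤ M * (48 * η) := by
    have h1 : ‖k * x‖ ≤ M * (48 * η) := by
      have : star (x * k) = k * x := by simp [hks, hx]
      rw [← this, norm_star]; exact b3
    have h2 : e + r = 1 - k := by rw [← hsum]; abel
    rw [h2]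
    exact aux_nr h1 (aux_proj_norm (aux_sub_proj hk))
  have b5 : ‖e * x * e - z‖ ≤ 2 * η := by
    have h1 : e * x * e - z = e * (p * x * p - cx) * e + (e * cx * e - z) := by
      have : e * (p * x * p - cx) * e = (e * p) * x * (p * e) - e * cx * e := by
        simp only [mul_sub, sub_mul, mul_assoc]
      rw [this, hep, hpe]; abel
    rw [h1]
    have h2 : ‖e * (p * x * p - cx) * e‖ ≤ η := aux_nr (aux_nl hen hcx.le) hen
    have := norm_add_le (e * (p * x * p - cx) * e) (e * cx * e - z)
    linarith
  have hdec : x - Y = e * x * r + r * x * e + x * k + k * x * (e + r) + (e * x * e - z)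
      + (z + r * x * r - Y) := by
    have h1 : x = (e + r + k) * x * (e + r + k) := by rw [hsum]; simp
    have h2 : x * k = (e + r + k) * x * k := by rw [hsum]; simp
    rw [h2]
    nth_rewrite 1 [h1]
    simp only [mul_add, add_mul]; abel
  rw [hdec]
  have n1 := norm_add_le (e * x * r + r * x * e + x * k + k * x * (e + r) + (e * x * e - z))
    (z + r * x * r - Y)
  have n2 := norm_add_le (e * x * r + r * x * e + x * k + k * x * (e + r)) (e * x * e - z)
  have n3 := norm_add_le (e * x * r + r * x * e + x * k) (k * x * (e + r))
  have n4 := norm_add_le (e * x * r + r * x * e) (x * k)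
  have n5 := norm_add_le (e * x * r) (r * x * e)
  have : ‖z + r * x * r - Y‖ ≤ ε / 4 := by linarith
  nlinarith

end helpers

/-- a simple unital C*-algebra which is tracially approximated by real rank
zero subalgebras has real rank zero. -/
theorem stmt16 {A : Type*} [CStarAlgebra A]
    (hsimple : ∀ I : TwoSidedIdeal A, IsClosed (I : Set A) →
      (∀ x ∈ I, x = (0 : A)) ∨ (∀ x : A, x ∈ I))
    (hTA : ∀ (F : Finset A) (ε : ℝ), 0 < ε → ∀ a : A, IsPositiveElem a → a ≠ 0 →
      ∃ (p : A) (C : NonUnitalStarSubalgebra ℂ A), IsClosed (C : Set A) ∧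
        IsProjection p ∧ p ≠ 0 ∧ p ∈ C ∧
        (∀ c ∈ C, p * c = c ∧ c * p = c) ∧
        (∀ y ∈ C, star y = y → ∀ δ : ℝ, 0 < δ →
          ∃ z ∈ C, star z = z ∧ (∃ w ∈ C, z * w = p ∧ w * z = p) ∧ ‖y - z‖ < δ) ∧
        (∀ x ∈ F, ‖x * p - p * x‖ < ε) ∧
        (∀ x ∈ F, ∃ c ∈ C, ‖p * x * p - c‖ < ε) ∧
        ProjSubEquiv (1 - p) a) :
    ∀ x : A, star x = x → ∀ ε : ℝ, 0 < ε →
      ∃ z : A, star z = z ∧ IsUnit z ∧ ‖x - z‖ < ε := by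
  intro x hx ε hε
  have hsa : IsSelfAdjoint x := hx
  by_cases hu : IsUnit x
  · exact ⟨x, hx, hu, by simpa using hε⟩
  have h0 : (0 : ℝ) ∈ spectrum ℝ x := by
    rw [spectrum.zero_mem_iff]; exact hu
  obtain ⟨κ, hκ⟩ : ∃ κ, κ = ε / 4 := ⟨_, rfl⟩
  have hκ0 : 0 < κ := by rw [hκ]; positivity
  set f : ℝ → ℝ := fun t => max 0 (κ - |t|) with hf
  set g : ℝ → ℝ := fun t => t - max (-κ) (min κ t) with hg
  have hfc : Continuous f := by fun_prop
  have hgc : Continuous g := by fun_prop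
  have hgf : ∀ t, g t * (f t * f t) = 0 := by
    intro t
    rcases le_total κ |t| with h | h
    · have : f t = 0 := by simp only [hf]; exact max_eq_left (by linarith)
      rw [this]; simp
    · have h' := abs_le.1 h
      have : g t = 0 := by
        simp only [hg]; rw [min_eq_right h'.2, max_eq_right h'.1, sub_self]
      rw [this]; simp
  have hgt : ∀ t, |t - g t| ≤ κ := by
    intro t
    simp only [hg, sub_sub_cancel]
    rw [abs_le]
    exact ⟨le_max_left _ _, max_le (by linarith) (min_le_left _ _)⟩
  set y := cfc f x with hy
  have hys : star y = y := (cfc_predicate f x : IsSelfAdjoint _)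
  set a := y * y with ha
  have hacfc : a = cfc (fun t => f t * f t) x := by rw [cfc_mul f f x]
  have ha0 : a ≠ 0 := by
    intro h
    have h1 : ‖cfc (fun t => f t * f t) x‖ ≤ 0 := by rw [← hacfc, h, norm_zero]
    have h2 := (norm_cfc_le_iff (fun t => f t * f t) x le_rfl).1 h1 0 h0
    have h3 : f 0 = κ := by simp only [hf]; simp [hκ0.le]
    rw [h3] at h2
    have h4 : κ * κ = 0 := norm_le_zero_iff.1 h2
    nlinarith
  set x₁ := cfc g x with hx1
  have hx1s : star x₁ = x₁ := (cfc_predicate g x : IsSelfAdjoint _)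
  have hx1a : x₁ * a = 0 := by
    rw [hacfc, hx1, ← cfc_mul g (fun t => f t * f t) x]
    simp only [hgf]
    exact cfc_const_zero ℝ x
  have hxx1 : ‖x - x₁‖ ≤ κ := by
    have : x - x₁ = cfc (fun t => t - g t) x := by
      rw [cfc_sub (fun t => t) g x, cfc_id' ℝ x]
    rw [this]
    exact norm_cfc_le hκ0.le fun t _ => by simpa using hgt t
  obtain ⟨p, C, hCc, hp, -, hpC, hunit, hRR, hcom, happ, v, hvv, hvH⟩ :=
    hTA {x} κ hκ0 a ⟨y, by rw [hys]⟩ ha0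
  by_cases hp1 : p = 1
  · subst hp1
    obtain ⟨c, hcC, hcs, hc⟩ := aux_symm C (1 * x * 1) (by simp [hx]) κ (happ x (by simp))
    obtain ⟨z, hzC, hzs, ⟨w, -, hzw, hwz⟩, hz⟩ := hRR c hcC hcs κ hκ0
    refine ⟨z, hzs, ⟨⟨z, w, hzw, hwz⟩, rfl⟩, ?_⟩
    rw [one_mul, mul_one] at hc
    have : x - z = (x - c) + (c - z) := by abel
    rw [this]
    have := norm_add_le (x - c) (c - z)
    linarith
  · have hP := aux_sub_proj hp
    set P := 1 - p with hPdef
    have hPv : P * v = v := by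
      have h : (v - P * v) * star (v - P * v) = 0 := by
        simp only [star_sub, star_mul, hP.1, sub_mul, mul_sub]
        have h1 : P * v * star v = P := by rw [mul_assoc, hvv, hP.2]
        have h2 : v * (star v * P) = P := by rw [← mul_assoc, hvv, hP.2]
        have h3 : P * v * (star v * P) = P := by rw [← mul_assoc, h1, hP.2]
        rw [hvv, h1, h2, h3]; simp
      have := CStarRing.mul_star_self_eq_zero_iff _ |>.1 h
      exact (sub_eq_zero.1 this).symm
    have hq : IsProjection (star v * v) := by
      refine ⟨by simp, ?_⟩
      rw [mul_assoc, ← mul_assoc v, hvv, hPv]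
    have hq0 : star v * v ≠ 0 := by
      intro h
      have h1 := CStarRing.star_mul_self_eq_zero_iff _ |>.1 h
      rw [h1, zero_mul] at hvv
      exact hp1 (sub_eq_zero.1 hvv.symm).symm
    obtain ⟨z, hzs, hzu, hz⟩ := aux_main hTA x₁ (star v * v) hx1s hq hq0
      (aux_her_zero hx1a hvH) κ hκ0
    refine ⟨z, hzs, hzu, ?_⟩
    have : x - z = (x - x₁) + (x₁ - z) := by abel
    rw [this]
    have := norm_add_le (x - x₁) (x₁ - z)
    linarith
end

section
/- Let N ≥ 1 and let (t_i)_{i ∈ ℕ} be a sequence of functions t_i : ℤ/Nℤ → ℂ taking nonnegative real values with Σ_{h ∈ ℤ/Nℤ} t_i(h) = 1 for every i. Let T_i be the circulant matrix T_i(g,h) = t_i(g − h) over ℂ. Then there exists a strictly increasing sequence (n_k)_{k ∈ ℕ} of natural numbers such that for every m, the partial products ∏_{i = n_m}^{n_l} T_i converge (entrywise, i.e. in M_N(ℂ)) as l → ∞. (All the T_i commute, being circulant, so the order of multiplication is immaterial.) -/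
open scoped ComplexOrder

/-- for a sequence of stochastic circulant matrices there is a telescoping
(a strictly increasing sequence of indices) along which all tail partial products
converge. The partial product `∏_{i = n m}^{n l} T i` is written as an ordered list
product (all the matrices involved commute, being circulant). -/
theorem stmt17 (N : ℕ) [NeZero N] (t : ℕ → ZMod N → ℂ)
    (ht0 : ∀ (i : ℕ) (h : ZMod N), 0 ≤ t i h)
    (ht1 : ∀ i : ℕ, ∑ h : ZMod N, t i h = 1)
    (T : ℕ → Matrix (ZMod N) (ZMod N) ℂ)
    (hT : ∀ i, T i = Matrix.circulant (t i)) :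
    ∃ n : ℕ → ℕ, StrictMono n ∧
      ∀ m : ℕ, ∃ L : Matrix (ZMod N) (ZMod N) ℂ,
        Filter.Tendsto
          (fun l : ℕ => ((List.range (n l + 1 - n m)).map (fun j => T (n m + j))).prod)
          Filter.atTop (nhds L) := by
  have hmem : ∀ i, T i ∈ Matrix.rowStochastic ℂ (ZMod N) := by
    intro i
    rw [Matrix.mem_rowStochastic_iff_sum, hT i]
    refine ⟨fun g h => ht0 i _, fun g => ?_⟩
    rw [← ht1 i]
    exact Fintype.sum_equiv (Equiv.subLeft g) _ _ (fun h => rfl)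
  let F : ℕ → ℕ → ZMod N → ZMod N → ℂ := fun b a =>
    ((List.range (b + 1 - a)).map (fun j => T (a + j))).prod
  have hF : ∀ b a, (F b a : Matrix (ZMod N) (ZMod N) ℂ) ∈ Matrix.rowStochastic ℂ (ZMod N) := by
    intro b a
    apply Submonoid.list_prod_mem
    intro x hx
    obtain ⟨j, -, rfl⟩ := List.mem_map.1 hx
    exact hmem _
  have hK : IsCompact (Set.univ.pi (fun _ : ℕ => Set.univ.pi (fun _ : ZMod N =>
      Set.univ.pi (fun _ : ZMod N => Metric.closedBall (0 : ℂ) 1)))) :=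
    isCompact_univ_pi fun _ => isCompact_univ_pi fun _ => isCompact_univ_pi fun _ =>
      isCompact_closedBall _ _
  have hFK : ∀ b, F b ∈ (Set.univ.pi (fun _ : ℕ => Set.univ.pi (fun _ : ZMod N =>
      Set.univ.pi (fun _ : ZMod N => Metric.closedBall (0 : ℂ) 1)))) := by
    intro b a _ g _ h _
    have h0 : 0 ≤ F b a g h := Matrix.nonneg_of_mem_rowStochastic (hF b a)
    have h1 : F b a g h ≤ 1 := Matrix.le_one_of_mem_rowStochastic (hF b a)
    rw [mem_closedBall_zero_iff]
    simpa using CStarAlgebra.norm_le_norm_of_nonneg_of_le h0 h1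
  obtain ⟨L, -, φ, hφ, hL⟩ := hK.tendsto_subseq hFK
  refine ⟨φ, hφ, fun m => ⟨L (φ m), ?_⟩⟩
  exact (tendsto_pi_nhds.1 hL) (φ m)
end
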